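/- arXiv:2409.16087 — 5 statements merged into one kernel-verified Lean document; each statement's English description precedes it below -/
import Mathlib

section
/- Let a ∈ ℝ, α ∈ (0,1], and let f₁, f₂ : ℝ → ℝ be functions that are left α-conformably differentiable (based at a) at a point t > a. Then the product f₁·f₂ is left α-conformably differentiable at t and T_α^a(f₁ f₂)(t) = f₁(t)·(T_α^a f₂)(t) + f₂(t)·(T_α^a f₁)(t). -/
/-- `f` is left `α`-conformably differentiable (based at `a`) at `t` with derivative `L`. -/
def HasLeftConfDerivAt (a α : ℝ) (f : ℝ → ℝ) (t L : ℝ) : Prop :=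
  Filter.Tendsto (fun ε : ℝ => (f (t + ε * (t - a) ^ (1 - α)) - f t) / ε)
    (nhdsWithin 0 {(0 : ℝ)}ᶜ) (nhds L)

/-- The conformable derivative of `f` at `t` is the derivative at `0` of
`ε ↦ f (t + ε * (t - a) ^ (1 - α))`. -/
theorem hasLeftConfDerivAt_iff_hasDerivAt {a α : ℝ} {f : ℝ → ℝ} {t L : ℝ} :
    HasLeftConfDerivAt a α f t L ↔
      HasDerivAt (fun ε : ℝ => f (t + ε * (t - a) ^ (1 - α))) L 0 := by
  simp only [HasLeftConfDerivAt, hasDerivAt_iff_tendsto_slope_zero, zero_add, zero_mul, add_zero,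
    smul_eq_mul, div_eq_inv_mul]

theorem conf_deriv_mul (a α : ℝ) (hα : α ∈ Set.Ioc (0 : ℝ) 1)
    (f₁ f₂ : ℝ → ℝ) (t : ℝ) (ht : a < t) (L₁ L₂ : ℝ)
    (h₁ : HasLeftConfDerivAt a α f₁ t L₁) (h₂ : HasLeftConfDerivAt a α f₂ t L₂) :
    HasLeftConfDerivAt a α (fun s => f₁ s * f₂ s) t (f₁ t * L₂ + f₂ t * L₁) := by
  rw [hasLeftConfDerivAt_iff_hasDerivAt] at h₁ h₂ ⊢
  have h := h₁.fun_mul h₂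
  rw [zero_mul, add_zero] at h
  rwa [add_comm, mul_comm (f₂ t)]
end

section
/- Let a ∈ ℝ, α ∈ (0,1], and let f₁, f₂ : ℝ → ℝ be functions that are left α-conformably differentiable (based at a) at a point t > a, with f₂(t) ≠ 0. Then the quotient f₁/f₂ is left α-conformably differentiable at t and T_α^a(f₁/f₂)(t) = (f₂(t)·(T_α^a f₁)(t) − f₁(t)·(T_α^a f₂)(t)) / (f₂(t))². -/
theorem conf_deriv_div (a α : ℝ) (hα : α ∈ Set.Ioc (0 : ℝ) 1)
    (f₁ f₂ : ℝ → ℝ) (t : ℝ) (ht : a < t) (L₁ L₂ : ℝ)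
    (h₁ : HasLeftConfDerivAt a α f₁ t L₁) (h₂ : HasLeftConfDerivAt a α f₂ t L₂)
    (hne : f₂ t ≠ 0) :
    HasLeftConfDerivAt a α (fun s => f₁ s / f₂ s) t
      ((f₂ t * L₁ - f₁ t * L₂) / (f₂ t) ^ 2) := by
  rw [hasLeftConfDerivAt_iff_hasDerivAt] at h₁ h₂ ⊢
  have h := h₁.fun_div h₂ (by simpa using hne)
  simp only [zero_mul, add_zero] at h
  rwa [mul_comm (f₂ t) L₁]
end

section
/- Let a ∈ ℝ, α ∈ (0,1], and let f, g : ℝ → ℝ. Let t > a be such that g(t) > a, g is left α-conformably differentiable (based at a) at t, and f is left α-conformably differentiable (based at a) at the point g(t). Assume moreover that g is differentiable at t in the ordinary sense and f is differentiable at g(t) in the ordinary sense. Then the composite h(t) = f(g(t)) is left α-conformably differentiable (based at a) at t and (T_α^a h)(t) = (T_α^a f)(g(t)) · (T_α^a g)(t) · (g(t) − a)^{α−1}. -/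
theorem HasDerivAt.hasLeftConfDerivAt {f : ℝ → ℝ} {f' t : ℝ} (h : HasDerivAt f f' t)
    (a α : ℝ) : HasLeftConfDerivAt a α f t (f' * (t - a) ^ (1 - α)) := by
  have hline : HasDerivAt (fun ε : ℝ => t + ε * (t - a) ^ (1 - α)) ((t - a) ^ (1 - α)) 0 := by
    simpa using ((hasDerivAt_id (0 : ℝ)).mul_const ((t - a) ^ (1 - α))).const_add t
  have hcomp := HasDerivAt.comp (h₂ := f) (h₂' := f') 0 (by simpa using h) hline
  rw [hasDerivAt_iff_tendsto_slope_zero] at hcomp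
  refine hcomp.congr fun ε => ?_
  simp [div_eq_inv_mul]

theorem HasLeftConfDerivAt.unique {a α : ℝ} {f : ℝ → ℝ} {t L L' : ℝ}
    (h : HasLeftConfDerivAt a α f t L) (h' : HasLeftConfDerivAt a α f t L') : L = L' :=
  tendsto_nhds_unique h h'

theorem conf_deriv_chain (a α : ℝ) (hα : α ∈ Set.Ioc (0 : ℝ) 1)
    (f g : ℝ → ℝ) (t : ℝ) (ht : a < t) (hgt : a < g t)
    (Lf Lg : ℝ)
    (hg : HasLeftConfDerivAt a α g t Lg)
    (hf : HasLeftConfDerivAt a α f (g t) Lf)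
    (hg' : DifferentiableAt ℝ g t)
    (hf' : DifferentiableAt ℝ f (g t)) :
    HasLeftConfDerivAt a α (fun s => f (g s)) t (Lf * Lg * (g t - a) ^ (α - 1)) := by
  rw [hg.unique (hg'.hasDerivAt.hasLeftConfDerivAt a α),
    hf.unique (hf'.hasDerivAt.hasLeftConfDerivAt a α)]
  have hpow : (g t - a) ^ (1 - α) * (g t - a) ^ (α - 1) = 1 := by
    rw [← Real.rpow_add (sub_pos.2 hgt)]
    simp
  have hcomp := (hf'.hasDerivAt.comp t hg'.hasDerivAt).hasLeftConfDerivAt a α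
  have hval : deriv f (g t) * (g t - a) ^ (1 - α) * (deriv g t * (t - a) ^ (1 - α)) *
      (g t - a) ^ (α - 1) = deriv f (g t) * deriv g t * (t - a) ^ (1 - α) := by
    linear_combination deriv f (g t) * deriv g t * (t - a) ^ (1 - α) * hpow
  rw [hval]
  exact hcomp
end

section
/- Let α ∈ (0,1], let t > 0, let n be a positive natural number, and let U : ℝ → Matrix (Fin n) (Fin n) ℝ be a matrix-valued function such that every entry of U is left α-conformably differentiable (based at 0) at t, U is continuous at t, and U(t) is invertible. Then every entry of the function V(s) = (U(s))⁻¹ (matrix inverse) is left α-conformably differentiable (based at 0) at t and V^{(α)}(t) = −U(t)⁻¹ · U^{(α)}(t) · U(t)⁻¹, where U^{(α)}(t) (respectively V^{(α)}(t)) denotes the matrix of entrywise left α-conformable derivatives of U (respectively V) at t. -/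
/-- The left `α`-conformable derivative of `f : ℝ → ℝ` at `t` based at `0`:
`f` has conformable derivative `L` at `t` if `(f (t + ε * t ^ (1 - α)) - f t) / ε → L`
as `ε → 0` over `ε ≠ 0`. -/
def HasConfDerivAt (α : ℝ) (f : ℝ → ℝ) (t L : ℝ) : Prop :=
  Filter.Tendsto (fun ε : ℝ => (f (t + ε * t ^ (1 - α)) - f t) / ε)
    (nhdsWithin 0 {(0 : ℝ)}ᶜ) (nhds L)

open Filter Topology in
theorem conf_deriv_matrix_inv (α : ℝ) (hα : α ∈ Set.Ioc (0 : ℝ) 1)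
    (t : ℝ) (ht : 0 < t) (n : ℕ) (hn : 0 < n)
    (U : ℝ → Matrix (Fin n) (Fin n) ℝ) (U' : Matrix (Fin n) (Fin n) ℝ)
    (hU : ∀ i j, HasConfDerivAt α (fun s => U s i j) t (U' i j))
    (hcont : ContinuousAt U t)
    (hinv : IsUnit (U t)) :
    ∀ i j, HasConfDerivAt α (fun s => (U s)⁻¹ i j) t
      ((-((U t)⁻¹ * U' * (U t)⁻¹)) i j) := by
  have hdet : (U t).det ≠ 0 := ((Matrix.isUnit_iff_isUnit_det _).1 hinv).ne_zero
  have hshift : Tendsto (fun ε : ℝ => t + ε * t ^ (1 - α)) (𝓝[≠] 0) (𝓝 t) := by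
    have h : Continuous fun ε : ℝ => t + ε * t ^ (1 - α) := by fun_prop
    simpa using (h.tendsto 0).mono_left nhdsWithin_le_nhds
  have hW := hcont.tendsto.comp hshift
  have hW_inv : Tendsto (fun ε : ℝ => (U (t + ε * t ^ (1 - α)))⁻¹) (𝓝[≠] 0) (𝓝 (U t)⁻¹) := by
    refine (continuousAt_matrix_inv (U t) ?_).tendsto.comp hW
    rw [Ring.inverse_eq_inv']
    exact continuousAt_inv₀ hdet
  have hW_det : ∀ᶠ ε : ℝ in 𝓝[≠] 0, (U (t + ε * t ^ (1 - α))).det ≠ 0 :=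
    ((continuous_id.matrix_det.tendsto (U t)).comp hW).eventually_ne hdet
  have hquot : Tendsto (fun ε : ℝ => ε⁻¹ • (U (t + ε * t ^ (1 - α)) - U t)) (𝓝[≠] 0) (𝓝 U') := by
    refine tendsto_pi_nhds.2 fun i => tendsto_pi_nhds.2 fun j => (hU i j).congr fun ε => ?_
    simp [div_eq_inv_mul]
  have hprod := ((hW_inv.mul hquot).mul_const (U t)⁻¹).neg
  intro i j
  refine (tendsto_pi_nhds.1 (tendsto_pi_nhds.1 hprod i) j).congr' ?_
  filter_upwards [hW_det] with ε hε
  have hmat : -((U (t + ε * t ^ (1 - α)))⁻¹ * (ε⁻¹ • (U (t + ε * t ^ (1 - α)) - U t)) * (U t)⁻¹)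
      = ε⁻¹ • ((U (t + ε * t ^ (1 - α)))⁻¹ - (U t)⁻¹) := by
    rw [Matrix.mul_smul, Matrix.smul_mul, ← smul_neg, mul_sub, sub_mul,
      Matrix.nonsing_inv_mul _ hε.isUnit, one_mul,
      Matrix.mul_nonsing_inv_cancel_right _ _ hdet.isUnit, neg_sub]
  rw [hmat]
  simp [div_eq_inv_mul]
end

section
/- Let α ∈ (0,1], let 0 < a ≤ b, let I ⊆ (0,∞) be an open interval, and let h : ℝ × ℝ → ℝ be continuous on I × [a,b] such that the partial derivative ∂h/∂t exists and is continuous on I × [a,b]. Then for every t ∈ I, the function F(t) = ∫_a^b h(t,s)·s^{α−1} ds is left α-conformably differentiable (based at 0) at t, and (T_α F)(t) = ∫_a^b (T_α h(·,s))(t) · s^{α−1} ds, where (T_α h(·,s))(t) denotes the left α-conformable derivative of the map t ↦ h(t,s) at t. -/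
open intervalIntegral

/-- A differentiable function is conformably differentiable, with the derivative rescaled by
`t ^ (1 - α)`. -/
theorem HasDerivAt.hasConfDerivAt {f : ℝ → ℝ} {f' t : ℝ} (hf : HasDerivAt f f' t) (α : ℝ) :
    HasConfDerivAt α f t (t ^ (1 - α) * f') := by
  have hline : HasDerivAt (fun ε : ℝ => t + ε * t ^ (1 - α)) (t ^ (1 - α)) 0 := by
    simpa using ((hasDerivAt_id (0 : ℝ)).mul_const (t ^ (1 - α))).const_add t
  have hcomp : HasDerivAt (fun ε : ℝ => f (t + ε * t ^ (1 - α))) (f' * t ^ (1 - α)) 0 :=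
    HasDerivAt.comp (h₂ := f) 0 (by simpa using hf) hline
  rw [hasDerivAt_iff_tendsto_slope_zero] at hcomp
  simpa [HasConfDerivAt, div_eq_inv_mul, mul_comm f'] using hcomp

/-- Differentiation under an interval integral with a continuous weight, for an integrand which is
continuous with continuous partial derivative on `I ×ˢ Set.Icc a b`, `I` open. -/
theorem hasDerivAt_integral_mul_of_continuousOn {a b : ℝ} (hab : a ≤ b) {I : Set ℝ}
    (hI : IsOpen I) {h h' : ℝ → ℝ → ℝ} {w : ℝ → ℝ}
    (hcont : ContinuousOn (fun p : ℝ × ℝ => h p.1 p.2) (I ×ˢ Set.Icc a b))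
    (hderiv : ∀ p ∈ I ×ˢ Set.Icc a b, HasDerivAt (fun u => h u p.2) (h' p.1 p.2) p.1)
    (hcont' : ContinuousOn (fun p : ℝ × ℝ => h' p.1 p.2) (I ×ˢ Set.Icc a b))
    (hw : ContinuousOn w (Set.Icc a b)) {t : ℝ} (ht : t ∈ I) :
    HasDerivAt (fun u => ∫ s in a..b, h u s * w s) (∫ s in a..b, h' t s * w s) t := by
  obtain ⟨δ, hδ, hball⟩ := Metric.nhds_basis_closedBall.mem_iff.1 (hI.mem_nhds ht)
  have hslice {g : ℝ → ℝ → ℝ}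
      (hg : ContinuousOn (fun p : ℝ × ℝ => g p.1 p.2) (I ×ˢ Set.Icc a b)) {u : ℝ} (hu : u ∈ I) :
      IntervalIntegrable (fun s => g u s * w s) MeasureTheory.volume a b := by
    refine ContinuousOn.intervalIntegrable_of_Icc hab (ContinuousOn.mul ?_ hw)
    exact hg.comp (f := fun s => (u, s)) (by fun_prop) fun s hs => ⟨hu, hs⟩
  have hweighted : ContinuousOn (fun p : ℝ × ℝ => h' p.1 p.2 * w p.2)
      (Metric.closedBall t δ ×ˢ Set.Icc a b) :=
    (hcont'.mono (Set.prod_mono_left hball)).mul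
      (hw.comp continuousOn_snd fun p hp => hp.2)
  obtain ⟨C, hC⟩ :=
    ((isCompact_closedBall t δ).prod isCompact_Icc).exists_bound_of_continuousOn hweighted
  have hmem {s : ℝ} (hs : s ∈ Set.uIoc a b) : s ∈ Set.Icc a b :=
    Set.Ioc_subset_Icc_self (Set.uIoc_of_le hab ▸ hs)
  refine (intervalIntegral.hasDerivAt_integral_of_dominated_loc_of_deriv_le
    (F := fun u s => h u s * w s) (F' := fun u s => h' u s * w s) (bound := fun _ => C)
    (Metric.closedBall_mem_nhds t hδ) ?_ (hslice hcont ht)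
    (intervalIntegrable_iff.1 (hslice hcont' ht)).aestronglyMeasurable ?_ intervalIntegrable_const ?_).2
  · filter_upwards [hI.mem_nhds ht] with u hu
    exact (intervalIntegrable_iff.1 (hslice hcont hu)).aestronglyMeasurable
  · exact .of_forall fun s hs u hu => hC (u, s) ⟨hu, hmem hs⟩
  · exact .of_forall fun s hs u hu => (hderiv (u, s) ⟨hball hu, hmem hs⟩).mul_const (w s)

theorem conf_deriv_under_integral (α : ℝ) (hα : α ∈ Set.Ioc (0 : ℝ) 1)
    (a b : ℝ) (ha : 0 < a) (hab : a ≤ b)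
    (c d : ℝ) (I : Set ℝ) (hI : I = Set.Ioo c d) (hIpos : I ⊆ Set.Ioi 0)
    (h h' : ℝ → ℝ → ℝ)
    (hcont : ContinuousOn (fun p : ℝ × ℝ => h p.1 p.2) (I ×ˢ Set.Icc a b))
    (hderiv : ∀ p ∈ I ×ˢ Set.Icc a b, HasDerivAt (fun u => h u p.2) (h' p.1 p.2) p.1)
    (hcont' : ContinuousOn (fun p : ℝ × ℝ => h' p.1 p.2) (I ×ˢ Set.Icc a b)) :
    ∀ t ∈ I, ∃ D : ℝ → ℝ,
      (∀ s ∈ Set.Icc a b, HasConfDerivAt α (fun u => h u s) t (D s)) ∧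
      HasConfDerivAt α (fun u => ∫ s in a..b, h u s * s ^ (α - 1)) t
        (∫ s in a..b, D s * s ^ (α - 1)) := by
  intro t ht
  refine ⟨fun s => t ^ (1 - α) * h' t s,
    fun s hs => (hderiv (t, s) ⟨ht, hs⟩).hasConfDerivAt α, ?_⟩
  have hw : ContinuousOn (fun s : ℝ => s ^ (α - 1)) (Set.Icc a b) :=
    continuousOn_id.rpow_const fun s hs => Or.inl (ha.trans_le hs.1).ne'
  have hF := hasDerivAt_integral_mul_of_continuousOn hab (hI ▸ isOpen_Ioo) hcont hderiv hcont' hw ht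
  simpa only [mul_assoc, intervalIntegral.integral_const_mul] using hF.hasConfDerivAt α
end
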